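/- arXiv:math/0307192 — 6 statements merged into one kernel-verified Lean document; each statement's English description precedes it below -/
import Mathlib

section
/- Let A be a unital C*-algebra and let q, x be selfadjoint elements of A with q² = 1, x q = −q x and ‖x‖ < √3/2. Then 1 − x² is a positive element of A, its positive square root z := √(1 − x²) (given by the continuous functional calculus) commutes with q, the element p := x + z q is selfadjoint and satisfies p² = 1, and moreover ‖z q − q‖ ≤ 1 − √(1 − ‖x‖²) < 1/2. -/
open scoped NNReal

/-- On the spectrum of `x`, the square of a real number is at most `‖x‖ ^ 2`. -/
lemma sq_le_norm_sq_of_mem_spectrum {A : Type*} [CStarAlgebra A] {x : A} {t : ℝ}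
    (ht : t ∈ spectrum ℝ x) : t ^ 2 ≤ ‖x‖ ^ 2 := by
  cases subsingleton_or_nontrivial A
  · simp [spectrum.of_subsingleton] at ht
  · have h : ‖t‖ ≤ ‖x‖ := spectrum.norm_le_norm_of_mem ht
    rw [← sq_abs t]
    exact pow_le_pow_left₀ (abs_nonneg t) h 2

/-- For a selfadjoint contraction `x`, `1 - x ^ 2` is the square of `√(1 - t ^ 2)` at `x`. -/
lemma cfc_sqrt_one_sub_sq_mul_self {A : Type*} [CStarAlgebra A] {x : A}
    (hx : IsSelfAdjoint x) (hx1 : ‖x‖ ≤ 1) :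
    cfc (fun t : ℝ ↦ √(1 - t ^ 2)) x * cfc (fun t : ℝ ↦ √(1 - t ^ 2)) x = 1 - x ^ 2 := by
  rw [← cfc_mul (fun t : ℝ ↦ √(1 - t ^ 2)) (fun t : ℝ ↦ √(1 - t ^ 2)) x]
  have h : (spectrum ℝ x).EqOn (fun t ↦ √(1 - t ^ 2) * √(1 - t ^ 2)) (fun t ↦ 1 - t ^ 2) := by
    intro t ht
    have h1 := sq_le_norm_sq_of_mem_spectrum ht
    have h2 : ‖x‖ ^ 2 ≤ 1 := pow_le_one₀ (norm_nonneg x) hx1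
    exact Real.mul_self_sqrt (by linarith)
  rw [cfc_congr h, cfc_sub (fun _ : ℝ ↦ (1 : ℝ)) (fun t ↦ t ^ 2) x, cfc_const_one ℝ x,
    cfc_pow_id x 2]

/-- For a selfadjoint contraction `x`, the distance from `√(1 - x ^ 2)` to `1` is at most
`1 - √(1 - ‖x‖ ^ 2)`. -/
lemma norm_cfc_sqrt_one_sub_sq_sub_one_le {A : Type*} [CStarAlgebra A] {x : A}
    (hx : IsSelfAdjoint x) :
    ‖cfc (fun t : ℝ ↦ √(1 - t ^ 2)) x - 1‖ ≤ 1 - √(1 - ‖x‖ ^ 2) := by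
  have h0 : √(1 - ‖x‖ ^ 2) ≤ 1 := Real.sqrt_le_one.mpr (by nlinarith [sq_nonneg ‖x‖])
  rw [← cfc_const_one ℝ x, ← cfc_sub (fun t : ℝ ↦ √(1 - t ^ 2)) (fun _ ↦ (1 : ℝ)) x]
  refine norm_cfc_le (by linarith) fun t ht ↦ ?_
  have h1 : √(1 - t ^ 2) ≤ 1 := Real.sqrt_le_one.mpr (by nlinarith [sq_nonneg t])
  have h2 : √(1 - ‖x‖ ^ 2) ≤ √(1 - t ^ 2) :=
    Real.sqrt_le_sqrt (by linarith [sq_le_norm_sq_of_mem_spectrum ht])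
  rw [Real.norm_eq_abs, abs_sub_comm, abs_of_nonneg (by linarith)]
  linarith

/-- A selfadjoint element squaring to `1` has norm at most `1`. -/
lemma IsSelfAdjoint.norm_le_one_of_sq_eq_one {A : Type*} [CStarAlgebra A] {q : A}
    (hq : IsSelfAdjoint q) (hq2 : q ^ 2 = 1) : ‖q‖ ≤ 1 := by
  nontriviality A
  have h : ‖q‖ * ‖q‖ = 1 := by
    rw [← CStarRing.norm_star_mul_self, hq.star_eq, ← sq, hq2, CStarRing.norm_one]
  nlinarith [norm_nonneg q]

/-- In a unital C*-algebra, if `q, x` are selfadjoint, `q ^ 2 = 1`,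
`x * q = - q * x` and `‖x‖ < √3 / 2`, then `1 - x ^ 2` is positive, its positive square root
`z := CFC.sqrt (1 - x ^ 2)` (continuous functional calculus) commutes with `q`,
`p := x + z * q` is selfadjoint with `p ^ 2 = 1`, and
`‖z * q - q‖ ≤ 1 - √(1 - ‖x‖ ^ 2) < 1 / 2`. -/
theorem stmt_1 {A : Type*} [CStarAlgebra A] [PartialOrder A] [StarOrderedRing A]
    (q x : A) (hq : IsSelfAdjoint q) (hx : IsSelfAdjoint x)
    (hq2 : q ^ 2 = 1) (hanti : x * q = -(q * x)) (hxn : ‖x‖ < Real.sqrt 3 / 2) :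
    0 ≤ 1 - x ^ 2 ∧
      CFC.sqrt (1 - x ^ 2) * q = q * CFC.sqrt (1 - x ^ 2) ∧
      IsSelfAdjoint (x + CFC.sqrt (1 - x ^ 2) * q) ∧
      (x + CFC.sqrt (1 - x ^ 2) * q) ^ 2 = 1 ∧
      ‖CFC.sqrt (1 - x ^ 2) * q - q‖ ≤ 1 - Real.sqrt (1 - ‖x‖ ^ 2) ∧
      1 - Real.sqrt (1 - ‖x‖ ^ 2) < 1 / 2 := by
  have hsq : ‖x‖ ^ 2 < 3 / 4 := by
    have h3 : √3 ^ 2 = (3 : ℝ) := Real.sq_sqrt (by norm_num)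
    nlinarith [norm_nonneg x]
  have hz2 := cfc_sqrt_one_sub_sq_mul_self hx (by nlinarith [norm_nonneg x])
  have hz0 : 0 ≤ cfc (fun t : ℝ ↦ √(1 - t ^ 2)) x :=
    cfc_nonneg fun _ _ ↦ Real.sqrt_nonneg _
  have hz1 := norm_cfc_sqrt_one_sub_sq_sub_one_le hx
  have hpos : 0 ≤ 1 - x ^ 2 := by
    rw [← hz2]
    exact (IsSelfAdjoint.of_nonneg hz0).mul_self_nonneg
  have hzx : Commute (cfc (fun t : ℝ ↦ √(1 - t ^ 2)) x) x :=
    (Commute.refl x).cfc_real _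
  have hcomm : Commute (CFC.sqrt (1 - x ^ 2)) q := by
    have h : Commute (1 - x ^ 2) q := by
      refine (Commute.one_left q).sub_left ?_
      rw [commute_iff_eq, sq, mul_assoc, hanti, mul_neg, ← mul_assoc, hanti, neg_mul, neg_neg,
        mul_assoc]
    rw [CFC.sqrt_eq_cfc]
    exact h.cfc_nnreal _
  rw [CFC.sqrt_unique hz2 hz0] at hcomm ⊢
  generalize cfc (fun t : ℝ ↦ √(1 - t ^ 2)) x = z at *
  have hzsa : IsSelfAdjoint z := IsSelfAdjoint.of_nonneg hz0
  refine ⟨hpos, hcomm, hx.add ((hzsa.commute_iff hq).mp hcomm), ?_, ?_, ?_⟩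
  · have h1 : x * (z * q) = -(z * q * x) := by
      rw [← mul_assoc, ← hzx.eq, mul_assoc, hanti, mul_neg, mul_assoc]
    have h2 : z * q * (z * q) = 1 - x ^ 2 := by
      rw [mul_assoc z, ← mul_assoc q, ← hcomm.eq, mul_assoc z q, ← mul_assoc z z, ← sq q, hq2, mul_one, hz2]
    rw [sq, add_mul, mul_add, mul_add, h1, h2, sq]
    abel
  · calc ‖z * q - q‖ = ‖(z - 1) * q‖ := by rw [sub_mul, one_mul]
      _ ≤ ‖z - 1‖ * ‖q‖ := norm_mul_le _ _
      _ ≤ ‖z - 1‖ := mul_le_of_le_one_right (norm_nonneg _) (hq.norm_le_one_of_sq_eq_one hq2)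
      _ ≤ 1 - √(1 - ‖x‖ ^ 2) := hz1
  · have h : 1 / 2 < √(1 - ‖x‖ ^ 2) := Real.lt_sqrt_of_sq_lt (by linarith)
    linarith
end

section
/- Let A be a unital C*-algebra and let p, q be selfadjoint elements of A with p² = q² = 1 and ‖p − q‖ < 2. Then p + q is invertible in A, and there exists a unitary element u of A (i.e. u* u = u u* = 1) such that u q u* = p; indeed u = (p + q)·|p + q|⁻¹·q has these properties, where |p + q| := √((p + q)²) is given by the continuous functional calculus. -/
/-- The sum of two involutions at distance less than `2` in a complete normed algebra is
invertible. -/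
theorem isUnit_add_of_sq_eq_one {A : Type*} [NormedRing A] [NormedAlgebra ℝ A] [CompleteSpace A]
    {p q : A} (hp2 : p ^ 2 = 1) (hq2 : q ^ 2 = 1) (hpq : ‖p - q‖ < 2) : IsUnit (p + q) := by
  set x : A := (1 / 2 : ℝ) • (p - q) with hx
  have hnx : ‖x‖ < 1 := by
    rw [hx, norm_smul]
    norm_num
    linarith
  have hnx2 : ‖x * x‖ < 1 := by
    nlinarith [norm_mul_le x x, norm_nonneg x]
  have hsq : (p + q) ^ 2 = (4 : ℝ) • (1 - x * x) := by
    have h1 : (p + q) ^ 2 + (p - q) ^ 2 = 4 := by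
      calc (p + q) ^ 2 + (p - q) ^ 2 = 2 * p ^ 2 + 2 * q ^ 2 := by noncomm_ring
        _ = 4 := by rw [hp2, hq2]; norm_num
    have h2 : (4 : ℝ) • (x * x) = (p - q) ^ 2 := by
      rw [hx, smul_mul_smul_comm, smul_smul, sq]
      norm_num
    have h4 : (4 : ℝ) • (1 : A) = 4 := by
      rw [← Algebra.algebraMap_eq_smul_one, map_ofNat]
    rw [smul_sub, h2, h4, ← h1, add_sub_cancel_right]
  have hu : IsUnit ((p + q) ^ 2) := by
    rw [hsq]
    exact (isUnit_one_sub_of_norm_lt_one hnx2).smul (Units.mk0 (4 : ℝ) (by norm_num))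
  exact (isUnit_pow_iff two_ne_zero).mp hu

/-- If `p ^ 2 = q ^ 2 = 1`, then `p` commutes with `(p + q) ^ 2`. -/
theorem commute_add_sq_of_sq_eq_one {R : Type*} [Ring R] {p q : R} (hp2 : p ^ 2 = 1)
    (hq2 : q ^ 2 = 1) : Commute p ((p + q) ^ 2) := by
  have h : (p + q) ^ 2 = 2 + p * q + q * p := by
    calc (p + q) ^ 2 = p ^ 2 + q ^ 2 + p * q + q * p := by noncomm_ring
      _ = 2 + p * q + q * p := by rw [hp2, hq2, one_add_one_eq_two]
  have h1 : p * (p * q) = q := by rw [← mul_assoc, ← sq, hp2, one_mul]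
  have h2 : q * p * p = q := by rw [mul_assoc, ← sq, hp2, mul_one]
  rw [h, commute_iff_eq, mul_add, mul_add, add_mul, add_mul, h1, h2, mul_two, two_mul, mul_assoc]
  abel


/-- In a unital C*-algebra, if `p, q` are selfadjoint with `p ^ 2 = q ^ 2 = 1` and
`‖p - q‖ < 2`, then `p + q` is invertible and `u := (p + q) * |p + q|⁻¹ * q` is a unitary element
with `u * q * u* = p`, where `|p + q| := CFC.sqrt ((p + q) ^ 2)`. -/
theorem stmt_3 {A : Type*} [CStarAlgebra A] [PartialOrder A] [StarOrderedRing A]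
    (p q : A) (hp : IsSelfAdjoint p) (hq : IsSelfAdjoint q)
    (hp2 : p ^ 2 = 1) (hq2 : q ^ 2 = 1) (hpq : ‖p - q‖ < 2) :
    IsUnit (p + q) ∧
      (p + q) * Ring.inverse (CFC.sqrt ((p + q) ^ 2)) * q ∈ unitary A ∧
      ((p + q) * Ring.inverse (CFC.sqrt ((p + q) ^ 2)) * q) * q *
          star ((p + q) * Ring.inverse (CFC.sqrt ((p + q) ^ 2)) * q) = p ∧
      ∃ u ∈ unitary A, u * q * star u = p := by
  have hunit := isUnit_add_of_sq_eq_one hp2 hq2 hpq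
  have hcp := commute_add_sq_of_sq_eq_one hp2 hq2
  have hcq : Commute q ((p + q) ^ 2) := by
    rw [add_comm p q]
    exact commute_add_sq_of_sq_eq_one hq2 hp2
  have hs : IsSelfAdjoint (p + q) := hp.add hq
  have hnn : 0 ≤ (p + q) ^ 2 := hs.sq_nonneg
  set s := p + q with hs_def
  set a := CFC.sqrt (s ^ 2) with ha_def
  set b := Ring.inverse a with hb_def
  have haa : a * a = s * s := by rw [← sq s, CFC.sqrt_mul_sqrt_self _ hnn]
  have hau : IsUnit a := (CFC.isUnit_sqrt_iff _ hnn).mpr (hunit.pow 2)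
  have hba : b * a = 1 := Ring.inverse_mul_cancel a hau
  have hab : a * b = 1 := Ring.mul_inverse_cancel a hau
  have hca : ∀ {y : A}, Commute y (s ^ 2) → Commute y b := fun {y} hy ↦ by
    have hya : Commute y a := by
      rw [ha_def, CFC.sqrt_eq_cfc]
      exact (hy.symm.cfc_nnreal _).symm
    calc y * b = b * (a * y) * b := by rw [← mul_assoc, hba, one_mul]
      _ = b * y * (a * b) := by rw [← hya.eq]; simp only [mul_assoc]
      _ = b * y := by rw [hab, mul_one]
  have hqb : q * b = b * q := hca hcq
  have hsb : s * b = b * s := (hca hcp).add_left (hca hcq)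
  have hb : star b = b := by
    rw [hb_def, ← Ring.inverse_star, (CFC.sqrt_nonneg (s ^ 2)).isSelfAdjoint.star_eq]
  have hbbss : b * b * (s * s) = 1 := by
    rw [← haa, mul_assoc, ← mul_assoc b a a, hba, one_mul, hba]
  have hsbbs : s * b * (b * s) = 1 := by
    calc s * b * (b * s) = b * s * (b * s) := by rw [hsb]
      _ = b * (s * b) * s := by simp only [mul_assoc]
      _ = 1 := by rw [hsb, ← hbbss]; simp only [mul_assoc]
  have hbssb : b * s * (s * b) = 1 := by
    rw [← hsbbs, hsb]
  have hqq : q * q = 1 := by rw [← sq, hq2]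
  have hsq : s * q = p * s := by
    rw [hs_def, add_mul, mul_add, hqq, ← sq p, hp2, add_comm]
  have hstar : star (s * b * q) = q * (b * s) := by
    rw [star_mul, star_mul, hb, hs.star_eq, hq.star_eq]
  have hmem : s * b * q ∈ unitary A := by
    rw [Unitary.mem_iff, hstar]
    constructor
    · calc q * (b * s) * (s * b * q) = q * (b * s * (s * b)) * q := by simp only [mul_assoc]
        _ = 1 := by rw [hbssb, mul_one, hqq]
    · calc s * b * q * (q * (b * s)) = s * b * (q * q) * (b * s) := by simp only [mul_assoc]
        _ = 1 := by rw [hqq, mul_one, hsbbs]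
  have hconj : s * b * q * q * star (s * b * q) = p := by
    rw [hstar]
    calc s * b * q * q * (q * (b * s)) = s * b * (q * q) * q * (b * s) := by
          simp only [mul_assoc]
      _ = s * (b * q) * (b * s) := by rw [hqq, mul_one, mul_assoc s b q]
      _ = s * q * b * (b * s) := by rw [← hqb, mul_assoc s q b]
      _ = p * (s * b * (b * s)) := by rw [hsq]; simp only [mul_assoc]
      _ = p := by rw [hsbbs, mul_one]
  exact ⟨hunit, hmem, hconj, _, hmem, hconj⟩
end

section
/- Let A be a unital C*-algebra and let Q := {q ∈ A : q* = q and q² = 1}, equipped with the topology induced by the norm of A. For every p ∈ Q, the unitary orbit {u p u* : u ∈ A unitary} of p is both open and closed in Q. -/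
/-- An invertible element `h = star c * c` of a C*-algebra has a self-adjoint inverse square root
that commutes with everything commuting with `h`. -/
lemma exists_isSelfAdjoint_inv_sqrt {A : Type*} [CStarAlgebra A] (c : A)
    (hc : IsUnit (star c * c)) :
    ∃ s : A, IsSelfAdjoint s ∧ s * s * (star c * c) = 1 ∧
      ∀ b : A, Commute (star c * c) b → Commute s b := by
  have hsa : IsSelfAdjoint (star c * c) := .star_mul_self c
  have hpos : ∀ x ∈ spectrum ℝ (star c * c), 0 < x := fun x hx ↦
    lt_of_le_of_ne (spectrum_star_mul_self_nonneg x hx) fun h ↦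
      spectrum.zero_notMem ℝ hc (h ▸ hx)
  have hcont : ContinuousOn (fun x : ℝ ↦ (√x)⁻¹) (spectrum ℝ (star c * c)) :=
    Real.continuous_sqrt.continuousOn.inv₀ fun x hx ↦ (Real.sqrt_pos.2 (hpos x hx)).ne'
  refine ⟨cfc (fun x : ℝ ↦ (√x)⁻¹) (star c * c), cfc_predicate _ _, ?_,
    fun b hb ↦ hsa.commute_cfc hb _⟩
  conv_lhs => rw [← cfc_mul _ _ _ hcont hcont]
  nth_rewrite 2 [← cfc_id' ℝ (star c * c)]
  rw [← cfc_mul (fun x : ℝ ↦ (√x)⁻¹ * (√x)⁻¹) (fun x ↦ x) _ (hcont.mul hcont) continuousOn_id,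
    ← cfc_one ℝ (star c * c)]
  refine cfc_congr fun x hx ↦ ?_
  have h := hpos x hx
  simp only [Pi.one_apply]
  rw [← mul_inv, Real.mul_self_sqrt h.le, inv_mul_cancel₀ h.ne']

/-- Self-adjoint unitaries at distance less than `2` are unitarily conjugate. -/
lemma exists_unitary_conj_of_norm_sub_lt_two {A : Type*} [CStarAlgebra A] {p q : A}
    (hp : star p = p) (hp2 : p ^ 2 = 1) (hq : star q = q) (hq2 : q ^ 2 = 1)
    (h : ‖q - p‖ < 2) : ∃ u ∈ unitary A, q = u * p * star u := by
  rw [pow_two] at hp2 hq2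
  have hpu : p ∈ unitary A := by simp [Unitary.mem_iff, hp, hp2]
  have hpp (x : A) : p * (p * x) = x := by rw [← mul_assoc, hp2, one_mul]
  have hqq (x : A) : q * (q * x) = x := by rw [← mul_assoc, hq2, one_mul]
  set c : A := 1 + q * p with hc
  have hcs : star c = 1 + p * q := by simp [hc, hp, hq]
  have hcunit : IsUnit c := by
    have hlt : ‖(1 : A) - (2⁻¹ : ℝ) • c‖ < 1 := by
      have e : (1 : A) - (2⁻¹ : ℝ) • c = -((2⁻¹ : ℝ) • ((q - p) * p)) := by
        rw [sub_mul, hp2, hc]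
        module
      rw [e, norm_neg, norm_smul, CStarRing.norm_mul_mem_unitary _ hpu]
      norm_num
      linarith
    have h1 := isUnit_one_sub_of_norm_lt_one hlt
    rw [sub_sub_cancel] at h1
    have h2 : c = (Units.mk0 (2 : ℝ) two_ne_zero) • ((2⁻¹ : ℝ) • c) := by
      simp [Units.smul_def, smul_smul]
    rw [h2]
    exact h1.smul _
  have hcp : c * p = q * c := by
    simp only [hc, add_mul, mul_add, mul_assoc, hp2, hqq, one_mul, mul_one]
    abel
  have hnorm : star c * c = c * star c := by
    rw [hcs, hc]
    simp only [add_mul, mul_add, mul_assoc, hpp, hqq, hp2, hq2, one_mul, mul_one]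
    abel
  have hcomm : Commute (star c * c) p := by
    rw [Commute, SemiconjBy, hcs, hc]
    simp only [add_mul, mul_add, mul_assoc, hpp, hqq, hp2, one_mul, mul_one]
    abel
  have hcommc : Commute (star c * c) c := by
    simp only [Commute, SemiconjBy]
    nth_rewrite 1 [hnorm]
    rw [mul_assoc]
  obtain ⟨s, hs, hss, hsc⟩ := exists_isSelfAdjoint_inv_sqrt c (hcunit.star.mul hcunit)
  have hsp := (hsc p hcomm).eq
  have hsc' := (hsc c hcommc).eq
  have hsh := (hsc _ (Commute.refl _)).eq
  have hmul : c * s * (s * star c) = 1 := by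
    calc
      c * s * (s * star c) = s * (c * s) * star c := by
          rw [← mul_assoc s c s, hsc']; simp only [mul_assoc]
      _ = s * s * (c * star c) := by rw [← hsc']; simp only [mul_assoc]
      _ = 1 := by rw [← hnorm, hss]
  refine ⟨c * s, ?_, ?_⟩
  · rw [Unitary.mem_iff, star_mul, hs.star_eq]
    refine ⟨?_, hmul⟩
    calc s * star c * (c * s) = s * ((star c * c) * s) := by simp only [mul_assoc]
      _ = 1 := by rw [← hsh, ← mul_assoc, hss]
  · rw [star_mul, hs.star_eq]
    calc q = q * (c * s * (s * star c)) := by rw [hmul, mul_one]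
      _ = (q * c) * s * (s * star c) := by simp only [mul_assoc]
      _ = c * (p * s) * (s * star c) := by rw [← hcp]; simp only [mul_assoc]
      _ = c * s * p * (s * star c) := by rw [← hsp]; simp only [mul_assoc]

/-- In a unital C*-algebra `A`, let `Q := {q : A // star q = q ∧ q ^ 2 = 1}` with the
topology induced by the norm of `A`.  For every `p ∈ Q`, the unitary orbit
`{u p u* : u unitary}` of `p` is both open and closed in `Q`. -/
theorem stmt_4 {A : Type*} [CStarAlgebra A]
    (p : A) (hp : star p = p) (hp2 : p ^ 2 = 1) :
    IsOpen {q : {q : A // star q = q ∧ q ^ 2 = 1} | ∃ u ∈ unitary A, (q : A) = u * p * star u} ∧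
      IsClosed {q : {q : A // star q = q ∧ q ^ 2 = 1} | ∃ u ∈ unitary A, (q : A) = u * p * star u} := by
  have key (q r : {q : A // star q = q ∧ q ^ 2 = 1}) (hqr : dist r q < 2)
      (hq : ∃ u ∈ unitary A, (q : A) = u * p * star u) :
      ∃ u ∈ unitary A, (r : A) = u * p * star u := by
    obtain ⟨u, hu, hqu⟩ := hq
    rw [Subtype.dist_eq, dist_eq_norm] at hqr
    obtain ⟨v, hv, hrv⟩ :=
      exists_unitary_conj_of_norm_sub_lt_two q.2.1 q.2.2 r.2.1 r.2.2 hqr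
    exact ⟨v * u, mul_mem hv hu, by rw [hrv, hqu, star_mul]; simp only [mul_assoc]⟩
  rw [← isOpen_compl_iff, Metric.isOpen_iff, Metric.isOpen_iff]
  refine ⟨fun q hq ↦ ⟨2, two_pos, fun r hr ↦ key q r hr hq⟩,
    fun q hq ↦ ⟨2, two_pos, fun r hr hr' ↦ hq (key r q ?_ hr')⟩⟩
  rwa [dist_comm]
end

section
/- Let H be a complex Hilbert space and let Q be a bounded selfadjoint operator on H such that Q² − I is a compact operator. Then there exists a compact selfadjoint operator J on H such that (Q − J)² = I. -/
/-- An injective sequence of scalars bounded away from zero cannot lie entirely in the spectrum of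
a compact symmetric operator. -/
theorem IsCompactOperator.exists_notMem_spectrum {𝕜 H : Type*} [RCLike 𝕜] [NormedAddCommGroup H]
    [InnerProductSpace 𝕜 H] [CompleteSpace H] {T : H →L[𝕜] H} (hT : IsCompactOperator T)
    (hT' : T.IsSymmetric) {μ : ℕ → 𝕜} (hμ : Function.Injective μ) {δ : ℝ} (hδ : 0 < δ)
    (hμδ : ∀ n, δ ≤ ‖μ n‖) : ∃ n, μ n ∉ spectrum 𝕜 T := by
  by_contra! h
  have hev (n : ℕ) : ∃ e : H, ‖e‖ = 1 ∧ T e = μ n • e := by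
    have hne : μ n ≠ 0 := norm_pos_iff.mp (hδ.trans_le (hμδ n))
    obtain ⟨v, hv⟩ := ((hT.hasEigenvalue_iff_mem_spectrum hne).mpr (h n)).exists_hasEigenvector
    refine ⟨((‖v‖⁻¹ : ℝ) : 𝕜) • v, ?_, ?_⟩
    · rw [norm_smul, RCLike.norm_ofReal, abs_inv, abs_norm, inv_mul_cancel₀]
      exact norm_ne_zero_iff.mpr hv.2
    · have hTv : T v = μ n • v := hv.apply_eq_smul
      rw [map_smul, hTv, smul_comm]
  choose e he hTe using hev
  have horth {m n : ℕ} (hmn : m ≠ n) : inner 𝕜 (T (e m)) (T (e n)) = 0 := by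
    have h0 : inner 𝕜 (e m) (e n) = 0 :=
      hT'.orthogonalFamily_eigenspaces (hμ.ne hmn)
        ⟨e m, Module.End.mem_eigenspace_iff.mpr (hTe m)⟩
        ⟨e n, Module.End.mem_eigenspace_iff.mpr (hTe n)⟩
    rw [hTe, hTe, inner_smul_left, inner_smul_right, h0, mul_zero, mul_zero]
  have hsep {m n : ℕ} (hmn : m ≠ n) : δ ≤ dist (T (e m)) (T (e n)) := by
    have hle : δ ≤ ‖T (e m)‖ := by simpa [hTe, norm_smul, he] using hμδ m
    have hsq := norm_sub_sq (𝕜 := 𝕜) (T (e m)) (T (e n))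
    rw [horth hmn, map_zero] at hsq
    rw [dist_eq_norm]
    refine hle.trans (le_of_sq_le_sq ?_ (norm_nonneg _))
    nlinarith [sq_nonneg ‖T (e n)‖]
  obtain ⟨K, hK, hTK⟩ := hT.image_closedBall_subset_compact (f := (T : H →ₗ[𝕜] H)) 1
  obtain ⟨a, -, φ, hφ, hlim⟩ := hK.tendsto_subseq (x := fun n ↦ T (e n)) fun n ↦
    hTK ⟨e n, by simp [he], rfl⟩
  obtain ⟨N, hN⟩ := Metric.cauchySeq_iff'.mp hlim.cauchySeq δ hδ
  exact (hN (N + 1) N.le_succ).not_ge (hsep (hφ.injective.ne N.succ_ne_self))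

/-- The polynomial `x ^ 2 - 1` in the continuous functional calculus of a selfadjoint operator. -/
theorem IsSelfAdjoint.cfc_sq_sub_one {H : Type*} [NormedAddCommGroup H] [InnerProductSpace ℂ H]
    [CompleteSpace H] {Q : H →L[ℂ] H} (hQ : IsSelfAdjoint Q) :
    cfc (fun x : ℝ ↦ x ^ 2 - 1) Q = Q ^ 2 - 1 := by
  rw [cfc_sub _ _, cfc_pow_id Q 2, cfc_const_one ℝ Q]

/-- A selfadjoint operator whose square is a compact perturbation of the identity has a spectral
gap inside `(-1, 1)`. -/
theorem IsSelfAdjoint.exists_notMem_spectrum_of_isCompactOperator {H : Type*}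
    [NormedAddCommGroup H] [InnerProductSpace ℂ H] [CompleteSpace H] {Q : H →L[ℂ] H}
    (hQ : IsSelfAdjoint Q) (hcpt : IsCompactOperator ⇑(Q ^ 2 - 1 : H →L[ℂ] H)) :
    ∃ c : ℝ, |c| < 1 ∧ c ∉ spectrum ℝ Q := by
  have hc0 (n : ℕ) : 0 < ((n : ℝ) + 2)⁻¹ := by positivity
  have hc1 (n : ℕ) : ((n : ℝ) + 2)⁻¹ ≤ 1 / 2 := by
    rw [one_div]
    exact inv_anti₀ two_pos (by linarith [n.cast_nonneg (α := ℝ)])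
  have hK : IsSelfAdjoint (Q ^ 2 - 1) := (hQ.pow 2).sub (.one _)
  obtain ⟨n, hn⟩ := hcpt.exists_notMem_spectrum hK.isSymmetric
    (μ := fun n : ℕ ↦ ((((n : ℝ) + 2)⁻¹ ^ 2 - 1 : ℝ) : ℂ)) (δ := 3 / 4)
    (fun m n hmn ↦ by
      have h : ((m : ℝ) + 2)⁻¹ ^ 2 = ((n : ℝ) + 2)⁻¹ ^ 2 :=
        sub_left_injective (Complex.ofReal_injective hmn)
      have h' := (pow_left_inj₀ (hc0 m).le (hc0 n).le two_ne_zero).mp h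
      exact_mod_cast add_left_injective _ (inv_injective h'))
    (by norm_num)
    (fun n ↦ by
      rw [Complex.norm_real, Real.norm_eq_abs, le_abs]
      right
      nlinarith [hc0 n, hc1 n])
  refine ⟨((n : ℝ) + 2)⁻¹, ?_, fun hmem ↦ hn ?_⟩
  · rw [abs_of_pos (hc0 n)]
    linarith [hc1 n]
  · have hmap : spectrum ℝ (Q ^ 2 - 1) = (fun x : ℝ ↦ x ^ 2 - 1) '' spectrum ℝ Q := by
      rw [← hQ.cfc_sq_sub_one, cfc_map_spectrum ..]
    exact spectrum.algebraMap_mem ℂ (hmap ▸ Set.mem_image_of_mem _ hmem)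

/-- If `Q` is a bounded selfadjoint operator on a complex Hilbert space `H` such that
`Q ^ 2 - I` is compact, then there is a compact selfadjoint operator `J` with `(Q - J) ^ 2 = I`. -/
theorem stmt_5 {H : Type*} [NormedAddCommGroup H] [InnerProductSpace ℂ H] [CompleteSpace H]
    (Q : H →L[ℂ] H) (hQ : IsSelfAdjoint Q)
    (hcpt : IsCompactOperator ⇑((Q ^ 2 - 1 : H →L[ℂ] H))) :
    ∃ J : H →L[ℂ] H, IsSelfAdjoint J ∧ IsCompactOperator ⇑J ∧ (Q - J) ^ 2 = 1 := by
  obtain ⟨c, hc, hcQ⟩ := hQ.exists_notMem_spectrum_of_isCompactOperator hcpt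
  obtain ⟨hc1, hc2⟩ := abs_lt.mp hc
  let s : ℝ → ℝ := fun x ↦ if c < x then 1 else -1
  have hs2 (x : ℝ) : s x ^ 2 = 1 := by
    simp only [s]
    split_ifs <;> norm_num
  have hs : ContinuousOn s (spectrum ℝ Q) := by
    intro x hx
    refine ContinuousAt.continuousWithinAt ?_
    rcases lt_or_gt_of_ne (ne_of_mem_of_not_mem hx hcQ) with h | h
    · refine (continuousAt_const (y := (-1 : ℝ))).congr ?_
      filter_upwards [Iio_mem_nhds h] with y hy
      exact (if_neg (not_lt_of_gt hy)).symm
    · refine (continuousAt_const (y := (1 : ℝ))).congr ?_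
      filter_upwards [Ioi_mem_nhds h] with y hy
      exact (if_pos hy).symm
  have hne (x : ℝ) : x + s x ≠ 0 := by
    simp only [s]
    split_ifs with h
    · linarith
    · linarith
  clear_value s
  have hg : ContinuousOn (fun x ↦ (x + s x)⁻¹) (spectrum ℝ Q) :=
    (continuousOn_id.add hs).inv₀ fun x _ ↦ hne x
  have hJ : Q - cfc s Q = (Q ^ 2 - 1) * cfc (fun x ↦ (x + s x)⁻¹) Q := by
    have hsub : cfc (fun x ↦ x - s x) Q = Q - cfc s Q := by
      rw [cfc_sub (fun x ↦ x) s Q continuousOn_id hs, cfc_id' ℝ Q]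
    rw [← hsub, ← hQ.cfc_sq_sub_one, ← cfc_mul _ _ Q (by fun_prop) hg]
    congr 1
    ext x
    rw [eq_mul_inv_iff_mul_eq₀ (hne x)]
    linear_combination -hs2 x
  refine ⟨Q - cfc s Q, hQ.sub (cfc_predicate s Q), ?_, ?_⟩
  · rw [hJ]
    exact hcpt.comp_clm _
  · rw [sub_sub_cancel, ← cfc_pow s 2 Q hs]
    simp only [hs2]
    exact cfc_const_one ℝ Q
end

section
/- Let E and F be real Banach spaces and T : E → F a continuous linear surjective map. Then there exists a continuous (in general nonlinear) map s : F → E such that T(s(y)) = y for every y ∈ F; moreover s can be chosen with s(0) = 0 and positively homogeneous, i.e. s(t y) = t s(y) for all t ≥ 0 and y ∈ F. -/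
/-- A continuous, positively homogeneous approximate right inverse of a continuous linear
surjection between Banach spaces. -/
theorem exists_continuous_posHomogeneous_approx_rightInverse {E F : Type*}
    [NormedAddCommGroup E] [NormedSpace ℝ E] [CompleteSpace E]
    [NormedAddCommGroup F] [NormedSpace ℝ F] [CompleteSpace F]
    (T : E →L[ℝ] F) (hT : Function.Surjective T) :
    ∃ (C : ℝ) (g : F → E), Continuous g ∧ (∀ y, ‖g y‖ ≤ C * ‖y‖) ∧
      (∀ y, ‖y - T (g y)‖ ≤ 1 / 2 * ‖y‖) ∧
      ∀ t : ℝ, 0 ≤ t → ∀ y : F, g (t • y) = t • g y := by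
  obtain ⟨C, hC, hpre⟩ := T.exists_preimage_norm_le hT
  have hconvex (y : F) : Convex ℝ
      {x : E | ‖x‖ ≤ C * (‖y‖ + 1 / 2) ∧ ‖y - T x‖ ≤ 1 / 2} := by
    have h₁ := convex_closedBall (0 : E) (C * (‖y‖ + 1 / 2))
    have h₂ := (convex_closedBall y (1 / 2 : ℝ)).linear_preimage (T : E →ₗ[ℝ] F)
    convert h₁.inter h₂ using 1
    ext x
    simp [dist_eq_norm, norm_sub_rev y]
  obtain ⟨h, hh⟩ := exists_continuous_forall_mem_convex_of_local_const hconvex fun y ↦ by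
    obtain ⟨x, rfl, hx⟩ := hpre y
    refine ⟨x, ?_⟩
    filter_upwards [Metric.closedBall_mem_nhds (T x) (by norm_num : (0 : ℝ) < 1 / 2)] with z hz
    rw [Metric.mem_closedBall, dist_eq_norm] at hz
    refine ⟨hx.trans ?_, hz⟩
    gcongr
    linarith [norm_sub_norm_le (T x) z, norm_sub_rev (T x) z]
  have hunit {y : F} (hy : y ≠ 0) : ‖‖y‖⁻¹ • y‖ = 1 := by
    rw [norm_smul, norm_inv, norm_norm, inv_mul_cancel₀ (norm_ne_zero_iff.2 hy)]
  have hbound (y : F) : ‖‖y‖ • h (‖y‖⁻¹ • y)‖ ≤ C * (3 / 2) * ‖y‖ := by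
    rcases eq_or_ne y 0 with rfl | hy
    · simp
    have := (hh (‖y‖⁻¹ • y)).1
    rw [hunit hy] at this
    rw [norm_smul, norm_norm, mul_comm]
    gcongr
    linarith
  refine ⟨C * (3 / 2), fun y ↦ ‖y‖ • h (‖y‖⁻¹ • y), ?_, hbound, fun y ↦ ?_, fun t ht y ↦ ?_⟩
  · rw [continuous_iff_continuousAt]
    intro y
    rcases eq_or_ne y 0 with rfl | hy
    · have hlim : Filter.Tendsto (fun y : F ↦ C * (3 / 2) * ‖y‖) (nhds 0) (nhds 0) := by
        have : Continuous fun y : F ↦ C * (3 / 2) * ‖y‖ := by fun_prop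
        simpa using this.tendsto 0
      simpa [ContinuousAt] using squeeze_zero_norm hbound hlim
    · have hinv : ContinuousAt (fun y : F ↦ ‖y‖⁻¹ • y) y :=
        (continuous_norm.continuousAt.inv₀ (norm_ne_zero_iff.2 hy)).smul continuousAt_id
      exact continuous_norm.continuousAt.smul
        (ContinuousAt.comp (f := fun y : F ↦ ‖y‖⁻¹ • y) h.continuous.continuousAt hinv)
  · rcases eq_or_ne y 0 with rfl | hy
    · simp
    calc ‖y - T (‖y‖ • h (‖y‖⁻¹ • y))‖
        = ‖‖y‖ • (‖y‖⁻¹ • y - T (h (‖y‖⁻¹ • y)))‖ := by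
          rw [smul_sub, smul_inv_smul₀ (norm_ne_zero_iff.2 hy), map_smul]
      _ ≤ 1 / 2 * ‖y‖ := by
          rw [norm_smul, norm_norm, mul_comm]
          gcongr
          exact (hh (‖y‖⁻¹ • y)).2
  · rcases ht.eq_or_lt with rfl | ht
    · simp
    have : (t * ‖y‖)⁻¹ • t • y = ‖y‖⁻¹ • y := by
      rw [smul_smul, mul_inv, mul_right_comm, inv_mul_cancel₀ ht.ne', one_mul]
    simp only [norm_smul, Real.norm_of_nonneg ht.le, this, mul_smul]


/-- Bartle–Graves: A continuous linear surjection `T : E → F` between real Banach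
spaces admits a continuous (generally nonlinear) global section `s : F → E` with `T (s y) = y`
for all `y`; moreover `s` can be chosen with `s 0 = 0` and positively homogeneous:
`s (t • y) = t • s y` for all `t ≥ 0`. -/
theorem stmt_17 {E F : Type*} [NormedAddCommGroup E] [NormedSpace ℝ E] [CompleteSpace E]
    [NormedAddCommGroup F] [NormedSpace ℝ F] [CompleteSpace F]
    (T : E →L[ℝ] F) (hT : Function.Surjective T) :
    ∃ s : F → E, Continuous s ∧ (∀ y, T (s y) = y) ∧ s 0 = 0 ∧
      ∀ t : ℝ, 0 ≤ t → ∀ y : F, s (t • y) = t • s y := by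
  obtain ⟨C, g, hg, hgC, hgT, hgs⟩ :=
    exists_continuous_posHomogeneous_approx_rightInverse T hT
  set r : F → F := fun y ↦ y - T (g y) with hr
  have hrc : Continuous r := by fun_prop
  have hrs (t : ℝ) (ht : 0 ≤ t) (n : ℕ) (y : F) : r^[n] (t • y) = t • r^[n] y :=
    ((show Function.Semiconj (t • ·) r r from fun z ↦ by
      simp [hr, hgs t ht, smul_sub]).iterate_right n y).symm
  have hrn (n : ℕ) (y : F) : ‖r^[n] y‖ ≤ (1 / 2) ^ n * ‖y‖ := by
    induction n with
    | zero => simp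
    | succ n ih =>
      rw [Function.iterate_succ_apply', pow_succ']
      linarith [hgT (r^[n] y)]
  have hC : ∀ y : F, ‖g y‖ ≤ |C| * ‖y‖ := fun y ↦
    (hgC y).trans (by gcongr; exact le_abs_self C)
  have hgn (n : ℕ) (y : F) : ‖g (r^[n] y)‖ ≤ |C| * ((1 / 2) ^ n * ‖y‖) :=
    (hC _).trans (by gcongr; exact hrn n y)
  have hsum (R : ℝ) : Summable fun n : ℕ ↦ |C| * ((1 / 2) ^ n * R) :=
    (summable_geometric_two.mul_right R).mul_left |C|
  have hs (t : ℝ) (ht : 0 ≤ t) (y : F) :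
      ∑' n, g (r^[n] (t • y)) = t • ∑' n, g (r^[n] y) := by
    simp_rw [hrs t ht, hgs t ht]
    exact tsum_const_smul'' t
  refine ⟨fun y ↦ ∑' n, g (r^[n] y), ?_, fun y ↦ ?_, by simpa using hs 0 le_rfl 0, hs⟩
  · rw [continuous_iff_continuousAt]
    intro y
    have hcont : ContinuousOn (fun y ↦ ∑' n, g (r^[n] y)) (Metric.ball 0 (‖y‖ + 1)) := by
      refine continuousOn_tsum (fun n ↦ (hg.comp (hrc.iterate n)).continuousOn)
        (hsum (‖y‖ + 1)) fun n z hz ↦ (hgn n z).trans ?_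
      gcongr
      exact (mem_ball_zero_iff.1 hz).le
    exact hcont.continuousAt (Metric.isOpen_ball.mem_nhds (by simp))
  · have hsg : Summable fun n ↦ g (r^[n] y) := .of_norm_bounded (hsum ‖y‖) fun n ↦ hgn n y
    have hpart (n : ℕ) : ∑ i ∈ Finset.range n, T (g (r^[i] y)) = y - r^[n] y := by
      induction n with
      | zero => simp
      | succ n ih =>
        rw [Finset.sum_range_succ, ih, Function.iterate_succ_apply']
        simp only [hr]
        abel
    have hzero : Filter.Tendsto (fun n ↦ r^[n] y) Filter.atTop (nhds 0) :=
      squeeze_zero_norm (hrn · y) (by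
        simpa using (summable_geometric_two.mul_right ‖y‖).tendsto_atTop_zero)
    refine tendsto_nhds_unique (hsg.hasSum.mapL T).tendsto_sum_nat ?_
    simpa [hpart] using hzero.const_sub y
end

section
/- Let E and F be real Banach spaces, T : E → F a continuous linear surjective map, and C > 0 a constant such that every y ∈ F admits a preimage x ∈ E with T x = y and ‖x‖ ≤ C‖y‖ (such a constant exists by the open mapping theorem). Let S be a metric space and Ψ : S → F a continuous bounded map. Then there exists a continuous map Φ : S → E such that ‖Φ(x)‖ ≤ C · sup_{s∈S} ‖Ψ(s)‖ and ‖T(Φ(x)) − Ψ(x)‖ ≤ (1/2) · sup_{s∈S} ‖Ψ(s)‖ for every x ∈ S. -/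
/-- Let `T : E → F` be a continuous linear surjection of real Banach spaces and
`C > 0` a constant such that every `y` has a preimage `x` with `‖x‖ ≤ C ‖y‖`.  For every
continuous bounded map `Ψ : S → F` from a metric space `S` there is a continuous `Φ : S → E`
with `‖Φ x‖ ≤ C · sup ‖Ψ‖` and `‖T (Φ x) - Ψ x‖ ≤ (1/2) · sup ‖Ψ‖` for all `x ∈ S`. -/
theorem stmt_18 {E F S : Type*} [NormedAddCommGroup E] [NormedSpace ℝ E] [CompleteSpace E]
    [NormedAddCommGroup F] [NormedSpace ℝ F] [CompleteSpace F] [MetricSpace S]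
    (T : E →L[ℝ] F) (hT : Function.Surjective T)
    (C : ℝ) (hC : 0 < C) (hbound : ∀ y : F, ∃ x : E, T x = y ∧ ‖x‖ ≤ C * ‖y‖)
    (Ψ : S → F) (hΨc : Continuous Ψ) (hΨb : BddAbove (Set.range fun s : S => ‖Ψ s‖)) :
    ∃ Φ : S → E, Continuous Φ ∧ ∀ x : S,
      (‖Φ x‖ ≤ C * ⨆ s : S, ‖Ψ s‖) ∧
      ‖T (Φ x) - Ψ x‖ ≤ (1 / 2) * ⨆ s : S, ‖Ψ s‖ := by
  set M : ℝ := ⨆ s : S, ‖Ψ s‖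
  have hle (x : S) : ‖Ψ x‖ ≤ M := le_ciSup hΨb x
  have hM0 : 0 ≤ M := Real.iSup_nonneg fun _ => norm_nonneg _
  rcases hM0.eq_or_lt with h0 | hpos
  · refine ⟨fun _ => 0, continuous_const, fun x => ?_⟩
    have hx := hle x
    rw [← h0] at hx ⊢
    simpa using hx
  · let t : S → Set E := fun y =>
      Metric.closedBall 0 (C * M) ∩ T ⁻¹' Metric.closedBall (Ψ y) (1 / 2 * M)
    have ht (y : S) : Convex ℝ (t y) :=
      (convex_closedBall _ _).inter ((convex_closedBall _ _).linear_preimage T.toLinearMap)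
    obtain ⟨Φ, hΦ⟩ := exists_continuous_forall_mem_convex_of_local_const ht fun x => by
      obtain ⟨c, hTc, hc⟩ := hbound (Ψ x)
      refine ⟨c, ?_⟩
      filter_upwards [hΨc.continuousAt.eventually
        (Metric.closedBall_mem_nhds (Ψ x) (by positivity : 0 < 1 / 2 * M))] with y hy
      refine ⟨mem_closedBall_zero_iff.2 (hc.trans ?_), ?_⟩
      · gcongr
        exact hle x
      · rw [Set.mem_preimage, hTc]
        exact Metric.mem_closedBall_comm.1 hy
    exact ⟨Φ, Φ.continuous, fun x =>
      ⟨mem_closedBall_zero_iff.1 (hΦ x).1, mem_closedBall_iff_norm.1 (hΦ x).2⟩⟩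
end
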